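/- If u is a C² solution of Δu + k₀²u = f + ω²ξu on ℝ³ satisfying the Sommerfeld radiation condition, where f and ξ are continuous and compactly supported, then u satisfies the Lippmann–Schwinger integral equation u(x) = ∫ G(|x−x'|)f(x')dx' + ω²∫ G(|x−x'|)ξ(x')u(x')dx', where G(ρ) = −exp(ik₀ρ)/(4πρ). -/

import Mathlib

open MeasureTheory Filter Topology

/-- Three-dimensional Euclidean space. -/
abbrev E3 : Type := EuclideanSpace ℝ (Fin 3)

/-- The `i`-th standard basis vector. -/
noncomputable abbrev basisVec (i : Fin 3) : E3 := EuclideanSpace.single i 1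

lemma contDiff_mul_of_contDiffAt_tsupport {φ : E3 → ℝ} (hφ : ContDiff ℝ 1 φ) {V : E3 → ℂ}
    (hV : ∀ y ∈ tsupport φ, ContDiffAt ℝ 1 V y) :
    ContDiff ℝ 1 (fun y => (φ y : ℂ) * V y) := by
  rw [contDiff_iff_contDiffAt]
  intro y
  by_cases hy : y ∈ tsupport φ
  · exact (Complex.ofRealCLM.contDiff.contDiffAt.comp y hφ.contDiffAt).mul (hV y hy)
  · have : (fun y => (φ y : ℂ) * V y) =ᶠ[𝓝 y] fun _ => 0 := by
      filter_upwards [notMem_tsupport_iff_eventuallyEq.1 hy] with z hz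
      simp [hz]
    exact contDiffAt_const.congr_of_eventuallyEq this

lemma fderiv_ofReal_mul {φ : E3 → ℝ} {V : E3 → ℂ} {y : E3} (hφ : DifferentiableAt ℝ φ y)
    (hV : DifferentiableAt ℝ V y) (v : E3) :
    fderiv ℝ (fun y => (φ y : ℂ) * V y) y v
      = (fderiv ℝ φ y v : ℂ) * V y + φ y * fderiv ℝ V y v := by
  have h1 : HasFDerivAt (fun y => (φ y : ℂ)) (Complex.ofRealCLM.comp (fderiv ℝ φ y)) y :=
    Complex.ofRealCLM.hasFDerivAt.comp y hφ.hasFDerivAt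
  have h2 : HasFDerivAt (fun y => (φ y : ℂ) * V y) _ y := h1.mul hV.hasFDerivAt
  rw [h2.fderiv]
  simp
  ring

lemma continuous_mul_of_continuousAt_tsupport {α : E3 → ℝ} {s : Set E3} (hs : IsClosed s)
    (hα : Continuous α) (h0 : ∀ y ∉ s, α y = 0) {V : E3 → ℂ}
    (hV : ∀ y ∈ s, ContinuousAt V y) :
    Continuous (fun y => (α y : ℂ) * V y) := by
  rw [continuous_iff_continuousAt]
  intro y
  by_cases hy : y ∈ s
  · exact (Complex.continuous_ofReal.comp hα).continuousAt.mul (hV y hy)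
  · have : (fun y => (α y : ℂ) * V y) =ᶠ[𝓝 y] fun _ => 0 := by
      filter_upwards [hs.isOpen_compl.mem_nhds hy] with z hz
      simp [h0 z hz]
    exact continuousAt_const.congr this.symm

lemma fderiv_eq_zero_of_notMem_tsupport {φ : E3 → ℝ} {y : E3} (hy : y ∉ tsupport φ) :
    fderiv ℝ φ y = 0 := by
  rw [(notMem_tsupport_iff_eventuallyEq.1 hy).fderiv_eq]
  simp

lemma integral_fderiv_eq_zero {F : E3 → ℂ} (hF : ContDiff ℝ 1 F) (hFs : HasCompactSupport F)
    (v : E3) : ∫ y, fderiv ℝ F y v = 0 := by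
  have hi : Integrable (fun y => fderiv ℝ F y v) :=
    ((hF.continuous_fderiv one_ne_zero).clm_apply continuous_const).integrable_of_hasCompactSupport
      (hFs.fderiv_apply ℝ v)
  have := integral_mul_fderiv_eq_neg_fderiv_mul_of_integrable (μ := (volume : Measure E3))
    (f := fun _ => (1 : ℂ)) (g := F) (v := v)
    (by simp) (by simpa using hi)
    (by simpa using hF.continuous.integrable_of_hasCompactSupport hFs)
    (by fun_prop) fun x _ => hF.differentiable one_ne_zero x
  simpa using this

/-- Integration by parts of a vector field against a compactly supported cutoff. -/
lemma integral_cutoff_div {φ : E3 → ℝ} (hφ : ContDiff ℝ 1 φ) (hφs : HasCompactSupport φ)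
    {V : Fin 3 → E3 → ℂ} (hV : ∀ i, ∀ y ∈ tsupport φ, ContDiffAt ℝ 1 (V i) y) :
    Integrable (fun y => (φ y : ℂ) * ∑ i, fderiv ℝ (V i) y (basisVec i)) ∧
    Integrable (fun y => ∑ i, (fderiv ℝ φ y (basisVec i) : ℂ) * V i y) ∧
    ∫ y, (φ y : ℂ) * ∑ i, fderiv ℝ (V i) y (basisVec i)
      = - ∫ y, ∑ i, (fderiv ℝ φ y (basisVec i) : ℂ) * V i y := by
  have hF := fun i => contDiff_mul_of_contDiffAt_tsupport hφ (hV i)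
  have hFs : ∀ i, HasCompactSupport (fun y => (φ y : ℂ) * V i y) := fun i =>
    HasCompactSupport.mul_right (hφs.comp_left (g := ((↑) : ℝ → ℂ)) (by simp))
  have hB : Integrable (fun y => ∑ i, (fderiv ℝ φ y (basisVec i) : ℂ) * V i y) := by
    refine integrable_finsetSum _ fun i _ => ?_
    refine Continuous.integrable_of_hasCompactSupport ?_ ?_
    · refine continuous_mul_of_continuousAt_tsupport (isClosed_tsupport φ)
        ((hφ.continuous_fderiv one_ne_zero).clm_apply continuous_const) ?_
        fun y hy => (hV i y hy).continuousAt
      intro y hy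
      simp [fderiv_eq_zero_of_notMem_tsupport hy]
    · exact HasCompactSupport.mul_right
        ((hφs.fderiv_apply ℝ (basisVec i)).comp_left (g := ((↑) : ℝ → ℂ)) (by simp))
  have hT : Integrable (fun y => ∑ i, fderiv ℝ (fun y => (φ y : ℂ) * V i y) y (basisVec i)) :=
    integrable_finsetSum _ fun i _ =>
      (((hF i).continuous_fderiv one_ne_zero).clm_apply
        continuous_const).integrable_of_hasCompactSupport ((hFs i).fderiv_apply ℝ _)
  have hT0 : ∫ y, ∑ i, fderiv ℝ (fun y => (φ y : ℂ) * V i y) y (basisVec i) = 0 := by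
    rw [integral_finsetSum]
    · simp [fun i => integral_fderiv_eq_zero (hF i) (hFs i) (basisVec i)]
    · exact fun i _ => (((hF i).continuous_fderiv one_ne_zero).clm_apply
        continuous_const).integrable_of_hasCompactSupport ((hFs i).fderiv_apply ℝ _)
  have heq : (fun y => (φ y : ℂ) * ∑ i, fderiv ℝ (V i) y (basisVec i))
      = fun y => ∑ i, fderiv ℝ (fun y => (φ y : ℂ) * V i y) y (basisVec i)
        - ∑ i, (fderiv ℝ φ y (basisVec i) : ℂ) * V i y := by
    funext y
    by_cases hy : y ∈ tsupport φ
    · simp only [fun i => fderiv_ofReal_mul (hφ.differentiable one_ne_zero y)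
        ((hV i y hy).differentiableAt one_ne_zero) (basisVec i)]
      rw [Finset.sum_add_distrib, Finset.mul_sum]
      ring
    · have h1 : ∀ i, fderiv ℝ (fun y => (φ y : ℂ) * V i y) y = 0 := fun i => by
        have : (fun y => (φ y : ℂ) * V i y) =ᶠ[𝓝 y] fun _ => 0 := by
          filter_upwards [notMem_tsupport_iff_eventuallyEq.1 hy] with z hz
          simp [hz]
        rw [this.fderiv_eq]; simp
      simp [h1, fderiv_eq_zero_of_notMem_tsupport hy, image_eq_zero_of_notMem_tsupport hy]
  refine ⟨heq ▸ hT.sub hB, hB, ?_⟩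
  rw [heq, integral_sub hT hB, hT0, zero_sub]

/-- The radial profile of the outgoing fundamental solution of the Helmholtz equation. -/
noncomputable def greenProfile (k s : ℝ) : ℂ :=
  -Complex.exp (Complex.I * (k : ℂ) * s) / (4 * Real.pi * s)

/-- The function `s ↦ s⁻¹ * deriv (greenProfile k) s`. -/
noncomputable def greenSlope (k s : ℝ) : ℂ :=
  -Complex.exp (Complex.I * (k : ℂ) * s) / (4 * Real.pi) * (Complex.I * k / s ^ 2 - 1 / s ^ 3)

/-- The function `s ↦ s⁻¹ * deriv (greenSlope k) s`. -/
noncomputable def greenSlope₂ (k s : ℝ) : ℂ :=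
  -Complex.exp (Complex.I * (k : ℂ) * s) / (4 * Real.pi) *
    (-(k : ℂ) ^ 2 / s ^ 3 - 3 * Complex.I * k / s ^ 4 + 3 / s ^ 5)

lemma hasDerivAt_greenProfile (k : ℝ) {s : ℝ} (hs : s ≠ 0) :
    HasDerivAt (greenProfile k) (s * greenSlope k s) s := by
  have hid : HasDerivAt (fun t : ℝ => (t : ℂ)) 1 s := Complex.ofRealCLM.hasDerivAt
  have he := ((hid.const_mul (Complex.I * (k : ℂ))).cexp).neg
  have hsc : (s : ℂ) ≠ 0 := by exact_mod_cast hs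
  have hpi : (Real.pi : ℂ) ≠ 0 := by exact_mod_cast Real.pi_ne_zero
  have := he.div (hid.const_mul (4 * (Real.pi : ℂ))) (by simp [hs, hpi])
  refine this.congr_deriv ?_
  simp only [greenSlope, Pi.neg_apply]
  field_simp
  ring

lemma hasDerivAt_greenSlope (k : ℝ) {s : ℝ} (hs : s ≠ 0) :
    HasDerivAt (greenSlope k) (s * greenSlope₂ k s) s := by
  have hid : HasDerivAt (fun t : ℝ => (t : ℂ)) 1 s := Complex.ofRealCLM.hasDerivAt
  have he := (((hid.const_mul (Complex.I * (k : ℂ))).cexp).neg).div_const (4 * (Real.pi : ℂ))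
  have hsc : (s : ℂ) ≠ 0 := by exact_mod_cast hs
  have hpi : (Real.pi : ℂ) ≠ 0 := by exact_mod_cast Real.pi_ne_zero
  have h2 := (hasDerivAt_const s (Complex.I * (k : ℂ))).div (hid.pow 2) (by simp [hs])
  have h3 := (hasDerivAt_const s (1 : ℂ)).div (hid.pow 3) (by simp [hs])
  refine (he.mul (h2.sub h3)).congr_deriv ?_
  simp only [greenSlope₂, Pi.neg_apply, Pi.div_apply, Pi.sub_apply, Pi.pow_apply]
  field_simp
  ring_nf
  simp only [Complex.I_sq]
  ring

lemma contDiffAt_greenProfile (k : ℝ) {s : ℝ} (hs : s ≠ 0) :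
    ContDiffAt ℝ 1 (greenProfile k) s := by
  have hid : ContDiffAt ℝ 1 (fun t : ℝ => (t : ℂ)) s := Complex.ofRealCLM.contDiff.contDiffAt
  have hpi : (Real.pi : ℂ) ≠ 0 := by exact_mod_cast Real.pi_ne_zero
  have := ((contDiffAt_const (c := Complex.I * (k : ℂ))).mul hid).cexp.neg.mul
    (((contDiffAt_const (c := 4 * (Real.pi : ℂ))).mul hid).inv (by simp [hs, hpi]))
  refine this.congr_of_eventuallyEq (.of_forall fun t => ?_)
  simp [greenProfile, div_eq_mul_inv]

lemma contDiffAt_greenSlope (k : ℝ) {s : ℝ} (hs : s ≠ 0) :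
    ContDiffAt ℝ 1 (greenSlope k) s := by
  have hid : ContDiffAt ℝ 1 (fun t : ℝ => (t : ℂ)) s := Complex.ofRealCLM.contDiff.contDiffAt
  have := ((((contDiffAt_const (c := Complex.I * (k : ℂ))).mul hid).cexp.neg).div_const
    (4 * (Real.pi : ℂ))).mul
    (((contDiffAt_const (c := Complex.I * (k : ℂ))).mul ((hid.pow 2).inv (by simp [hs]))).sub
      ((contDiffAt_const (c := (1 : ℂ))).mul ((hid.pow 3).inv (by simp [hs]))))
  refine this.congr_of_eventuallyEq (.of_forall fun t => ?_)
  simp [greenSlope, div_eq_mul_inv]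

lemma hasFDerivAt_norm_sub_left {x y : E3} (h : y ≠ x) :
    HasFDerivAt (fun z => ‖x - z‖) (‖x - y‖⁻¹ • innerSL ℝ (y - x)) y := by
  have h0 : ‖x - y‖ ≠ 0 := by simpa [sub_eq_zero] using h.symm
  have h1 : HasFDerivAt (fun z : E3 => x - z) (-ContinuousLinearMap.id ℝ E3) y :=
    (hasFDerivAt_id y).const_sub x
  have := h1.norm_sq.sqrt (by positivity)
  simp only [Real.sqrt_sq (norm_nonneg _)] at this
  refine this.congr_fderiv ?_
  have h0' : (‖x - y‖ : ℂ) ≠ 0 := by exact_mod_cast h0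
  ext v
  simp
  field_simp

lemma hasFDerivAt_radial {g : ℝ → ℂ} {g' : ℂ} {x y : E3} (h : y ≠ x)
    (hg : HasDerivAt g (‖x - y‖ * g') ‖x - y‖) :
    HasFDerivAt (fun z => g ‖x - z‖) ((innerSL ℝ (y - x)).smulRight g') y := by
  have h0 : ‖x - y‖ ≠ 0 := by simpa [sub_eq_zero] using h.symm
  refine (hg.hasFDerivAt.comp y (hasFDerivAt_norm_sub_left h)).congr_fderiv ?_
  have h0' : (‖x - y‖ : ℂ) ≠ 0 := by exact_mod_cast h0
  ext v
  simp
  field_simp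

lemma contDiffAt_radial {g : ℝ → ℂ} {x y : E3} (h : y ≠ x)
    (hg : ContDiffAt ℝ 1 g ‖x - y‖) : ContDiffAt ℝ 1 (fun z => g ‖x - z‖) y :=
  hg.comp y ((contDiffAt_const.sub contDiffAt_id).norm ℝ (sub_ne_zero.2 h.symm))

lemma greenSlope_laplacian (k : ℝ) {s : ℝ} (hs : s ≠ 0) :
    s ^ 2 * greenSlope₂ k s + 3 * greenSlope k s = - (k : ℂ) ^ 2 * greenProfile k s := by
  have hsc : (s : ℂ) ≠ 0 := by exact_mod_cast hs
  have hpi : (Real.pi : ℂ) ≠ 0 := by exact_mod_cast Real.pi_ne_zero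
  simp only [greenSlope₂, greenSlope, greenProfile]
  field_simp
  ring

/-- The smooth cutoff equal to `1` near the ball of radius `r` around `a`. -/
noncomputable def cutoff (a : E3) (r : ℝ) (y : E3) : ℝ :=
  Real.smoothTransition (2 - ‖y - a‖ ^ 2 / r ^ 2)

/-- The weight such that the gradient of `cutoff a r` at `y` is `-cutoffWeight a r y • (y - a)`. -/
noncomputable def cutoffWeight (a : E3) (r : ℝ) (y : E3) : ℝ :=
  deriv Real.smoothTransition (2 - ‖y - a‖ ^ 2 / r ^ 2) * (2 / r ^ 2)

lemma contDiff_cutoff (a : E3) (r : ℝ) : ContDiff ℝ 1 (cutoff a r) :=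
  (Real.smoothTransition.contDiff (n := 1)).comp
    (contDiff_const.sub (((contDiff_id.sub contDiff_const).norm_sq ℝ).div_const _))

lemma hasFDerivAt_cutoff (a : E3) (r : ℝ) (y : E3) :
    HasFDerivAt (cutoff a r) (-cutoffWeight a r y • innerSL ℝ (y - a)) y := by
  have h1 : HasFDerivAt (fun z : E3 => z - a) (ContinuousLinearMap.id ℝ E3) y :=
    (hasFDerivAt_id y).sub_const a
  have h2 := ((h1.norm_sq.mul_const ((r ^ 2)⁻¹)).const_sub 2)
  have h3 : DifferentiableAt ℝ Real.smoothTransition (2 - ‖y - a‖ ^ 2 * (r ^ 2)⁻¹) :=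
    (Real.smoothTransition.contDiff (n := 1)).differentiable one_ne_zero _
  refine (h3.hasDerivAt.hasFDerivAt.comp y h2).congr_fderiv ?_
  ext v
  simp [cutoffWeight, div_eq_mul_inv]
  ring

lemma cutoff_eq_one {a : E3} {r : ℝ} (hr : 0 < r) {y : E3} (h : ‖y - a‖ ≤ r) :
    cutoff a r y = 1 := by
  refine Real.smoothTransition.one_of_one_le ?_
  have : ‖y - a‖ ^ 2 / r ^ 2 ≤ 1 := by
    rw [div_le_one (by positivity)]; gcongr
  linarith

lemma cutoff_eq_zero {a : E3} {r : ℝ} (hr : 0 < r) {y : E3} (h : 2 * r ≤ ‖y - a‖) :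
    cutoff a r y = 0 := by
  refine Real.smoothTransition.zero_of_nonpos ?_
  have : 2 ≤ ‖y - a‖ ^ 2 / r ^ 2 := by
    rw [le_div_iff₀ (by positivity)]; nlinarith
  linarith

lemma cutoff_nonneg (a : E3) (r : ℝ) (y : E3) : 0 ≤ cutoff a r y :=
  Real.smoothTransition.nonneg _

lemma cutoff_le_one (a : E3) (r : ℝ) (y : E3) : cutoff a r y ≤ 1 :=
  Real.smoothTransition.le_one _

lemma cutoffWeight_nonneg (a : E3) (r : ℝ) (y : E3) : 0 ≤ cutoffWeight a r y :=
  mul_nonneg Real.smoothTransition.monotone.deriv_nonneg (by positivity)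

lemma deriv_smoothTransition_of_one_lt {t : ℝ} (h : 1 < t) :
    deriv Real.smoothTransition t = 0 := by
  have : Real.smoothTransition =ᶠ[𝓝 t] fun _ => 1 := by
    filter_upwards [lt_mem_nhds h] with s hs
    exact Real.smoothTransition.one_of_one_le hs.le
  rw [this.deriv_eq]; simp

lemma deriv_smoothTransition_of_neg {t : ℝ} (h : t < 0) :
    deriv Real.smoothTransition t = 0 := by
  have : Real.smoothTransition =ᶠ[𝓝 t] fun _ => 0 := by
    filter_upwards [gt_mem_nhds h] with s hs
    exact Real.smoothTransition.zero_of_nonpos hs.le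
  rw [this.deriv_eq]; simp

lemma continuous_deriv_smoothTransition : Continuous (deriv Real.smoothTransition) :=
  (Real.smoothTransition.contDiff (n := 1)).continuous_deriv le_rfl

lemma continuous_cutoffWeight (a : E3) (r : ℝ) : Continuous (cutoffWeight a r) := by
  have := continuous_deriv_smoothTransition
  unfold cutoffWeight
  fun_prop

lemma cutoffWeight_support {a : E3} {r : ℝ} (hr : 0 < r) {y : E3}
    (h : cutoffWeight a r y ≠ 0) : r ≤ ‖y - a‖ ∧ ‖y - a‖ ≤ 2 * r := by
  constructor
  · by_contra! hlt
    refine h ?_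
    rw [cutoffWeight, deriv_smoothTransition_of_one_lt, zero_mul]
    have : ‖y - a‖ ^ 2 / r ^ 2 < 1 := by
      rw [div_lt_one (by positivity)]; gcongr
    linarith
  · by_contra! hlt
    refine h ?_
    rw [cutoffWeight, deriv_smoothTransition_of_neg, zero_mul]
    have : 2 < ‖y - a‖ ^ 2 / r ^ 2 := by
      rw [lt_div_iff₀ (by positivity)]; nlinarith
    linarith

lemma hasCompactSupport_of_norm_sub_le {α : Type*} [Zero α] {φ : E3 → α} (a : E3) (R : ℝ)
    (h : ∀ y, φ y ≠ 0 → ‖y - a‖ ≤ R) : HasCompactSupport φ :=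
  HasCompactSupport.intro (isCompact_closedBall a R) fun y hy => by
    by_contra h0
    exact hy (by simpa [dist_eq_norm] using h y h0)

lemma hasCompactSupport_cutoff (a : E3) {r : ℝ} (hr : 0 < r) : HasCompactSupport (cutoff a r) :=
  hasCompactSupport_of_norm_sub_le a (2 * r) fun _ hy => by
    by_contra! h
    exact hy (cutoff_eq_zero hr h.le)

lemma hasCompactSupport_cutoffWeight (a : E3) {r : ℝ} (hr : 0 < r) :
    HasCompactSupport (cutoffWeight a r) :=
  hasCompactSupport_of_norm_sub_le a (2 * r) fun _ hy => (cutoffWeight_support hr hy).2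

lemma cutoffWeight_eq_scale (a : E3) {r : ℝ} (hr : 0 < r) (z : E3) :
    cutoffWeight a r (a + r • z) = (r ^ 2)⁻¹ * cutoffWeight 0 1 z := by
  have : ‖r • z‖ ^ 2 / r ^ 2 = ‖z‖ ^ 2 := by
    rw [norm_smul, Real.norm_of_nonneg hr.le]; field_simp
  simp [cutoffWeight, this]
  ring

lemma integral_eq_scale {F : Type*} [NormedAddCommGroup F] [NormedSpace ℝ F]
    (h : E3 → F) (a : E3) {r : ℝ} (hr : 0 < r) :
    ∫ y, h y = r ^ 3 • ∫ z, h (a + r • z) := by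
  rw [Measure.integral_comp_smul volume (fun z => h (a + z)) r, integral_add_left_eq_self,
    smul_smul]
  simp [abs_of_pos hr, hr.ne']

lemma integral_cutoffWeight (a : E3) {r : ℝ} (hr : 0 < r) :
    ∫ y, cutoffWeight a r y = r * ∫ z, cutoffWeight 0 1 z := by
  rw [integral_eq_scale _ a hr]
  simp only [cutoffWeight_eq_scale a hr, integral_const_mul, smul_eq_mul]
  field_simp

lemma integral_cutoffWeight_div_norm :
    ∫ z : E3, cutoffWeight 0 1 z / (4 * Real.pi * ‖z‖) = 1 := by
  have h := integral_fun_norm_addHaar (volume : Measure E3)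
    (fun s : ℝ => deriv Real.smoothTransition (2 - s ^ 2) * 2 / (4 * Real.pi * s))
  simp only [cutoffWeight, sub_zero, one_pow, div_one]
  rw [h]
  have hd : ∀ s ∈ Set.Ici (0 : ℝ), HasDerivAt (fun s : ℝ => - Real.smoothTransition (2 - s ^ 2))
      (deriv Real.smoothTransition (2 - s ^ 2) * (2 * s)) s := by
    intro s _
    have h3 : DifferentiableAt ℝ Real.smoothTransition (2 - s ^ 2) :=
      (Real.smoothTransition.contDiff (n := 1)).differentiable one_ne_zero _
    have := (h3.hasDerivAt.comp s ((hasDerivAt_pow 2 s).const_sub 2)).neg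
    refine this.congr_deriv ?_
    simp
  have hsupp : HasCompactSupport
      (fun s : ℝ => deriv Real.smoothTransition (2 - s ^ 2) * (2 * s)) := by
    refine HasCompactSupport.intro (isCompact_closedBall (0 : ℝ) 2) fun s hs => ?_
    have : 2 < |s| := by simpa using hs
    rw [deriv_smoothTransition_of_neg, zero_mul]
    nlinarith [sq_abs s]
  have hi : IntegrableOn (fun s : ℝ => deriv Real.smoothTransition (2 - s ^ 2) * (2 * s))
      (Set.Ioi 0) := by
    refine (Continuous.integrable_of_hasCompactSupport ?_ hsupp).integrableOn
    have := continuous_deriv_smoothTransition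
    fun_prop
  have hl : Tendsto (fun s : ℝ => - Real.smoothTransition (2 - s ^ 2)) atTop (𝓝 0) := by
    refine tendsto_const_nhds.congr' ?_
    filter_upwards [eventually_ge_atTop 2] with s hs
    rw [Real.smoothTransition.zero_of_nonpos (by nlinarith), neg_zero]
  have hI := integral_Ioi_of_hasDerivAt_of_tendsto' hd hi hl
  have h1 : Real.smoothTransition (2 - (0 : ℝ) ^ 2) = 1 :=
    Real.smoothTransition.one_of_one_le (by norm_num)
  rw [h1] at hI
  have hc : ∫ y in Set.Ioi (0 : ℝ), y ^ (Module.finrank ℝ E3 - 1) •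
      (deriv Real.smoothTransition (2 - y ^ 2) * 2 / (4 * Real.pi * y))
      = ∫ y in Set.Ioi (0 : ℝ),
        (4 * Real.pi)⁻¹ * (deriv Real.smoothTransition (2 - y ^ 2) * (2 * y)) := by
    refine setIntegral_congr_fun measurableSet_Ioi fun s hs => ?_
    have : s ≠ 0 := ne_of_gt hs
    simp
    field_simp
  rw [hc, integral_const_mul, hI]
  simp [Measure.real, EuclideanSpace.volume_ball_fin_three]
  rw [ENNReal.toReal_ofReal (by positivity)]
  field_simp

/-- The `i`-th component of `K ∇u - u ∇K`, where `K` is the fundamental solution with pole `x`. -/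
noncomputable def greenField (k : ℝ) (u : E3 → ℂ) (x : E3) (i : Fin 3) (y : E3) : ℂ :=
  greenProfile k ‖x - y‖ * fderiv ℝ u y (basisVec i)
    - u y * (greenSlope k ‖x - y‖ * ((y i - x i : ℝ) : ℂ))

lemma contDiff_fderiv_apply {u : E3 → ℂ} (hu : ContDiff ℝ 2 u) (v : E3) :
    ContDiff ℝ 1 (fun y => fderiv ℝ u y v) :=
  (hu.fderiv_right (m := 1) (by norm_num)).clm_apply contDiff_const

lemma contDiffAt_greenField (k : ℝ) {u : E3 → ℂ} (hu : ContDiff ℝ 2 u) {x y : E3} (h : y ≠ x)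
    (i : Fin 3) : ContDiffAt ℝ 1 (greenField k u x i) y := by
  have h0 : ‖x - y‖ ≠ 0 := by simpa [sub_eq_zero] using h.symm
  have hc : ContDiff ℝ 1 (fun y : E3 => ((y i - x i : ℝ) : ℂ)) :=
    Complex.ofRealCLM.contDiff.comp
      (((EuclideanSpace.proj i : E3 →L[ℝ] ℝ).contDiff).sub contDiff_const)
  exact ((contDiffAt_radial h (contDiffAt_greenProfile k h0)).mul
    (contDiff_fderiv_apply hu _).contDiffAt).sub ((hu.of_le (by norm_num)).contDiffAt.mul
      ((contDiffAt_radial h (contDiffAt_greenSlope k h0)).mul hc.contDiffAt))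

lemma sum_fderiv_greenField {k : ℝ} {u g : E3 → ℂ} (hu : ContDiff ℝ 2 u)
    (hH : ∀ y, (∑ i, fderiv ℝ (fun z => fderiv ℝ u z (basisVec i)) y (basisVec i))
      + (k : ℂ) ^ 2 * u y = g y) {x y : E3} (h : y ≠ x) :
    ∑ i, fderiv ℝ (greenField k u x i) y (basisVec i) = greenProfile k ‖x - y‖ * g y := by
  have h0 : ‖x - y‖ ≠ 0 := by simpa [sub_eq_zero] using h.symm
  have hK := hasFDerivAt_radial h (hasDerivAt_greenProfile k h0)
  have hS := hasFDerivAt_radial h (hasDerivAt_greenSlope k h0)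
  have hpart : ∀ i, fderiv ℝ (greenField k u x i) y (basisVec i)
      = greenProfile k ‖x - y‖ * fderiv ℝ (fun z => fderiv ℝ u z (basisVec i)) y (basisVec i)
        - u y * (greenSlope₂ k ‖x - y‖ * ((y i - x i : ℝ) : ℂ) ^ 2 + greenSlope k ‖x - y‖) := by
    intro i
    have hc : HasFDerivAt (fun y : E3 => ((y i - x i : ℝ) : ℂ))
        (Complex.ofRealCLM.comp (EuclideanSpace.proj i : E3 →L[ℝ] ℝ)) y :=
      Complex.ofRealCLM.hasFDerivAt.comp y
        (((EuclideanSpace.proj i : E3 →L[ℝ] ℝ).hasFDerivAt).sub_const (x i))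
    have hui := ((contDiff_fderiv_apply hu (basisVec i)).differentiable one_ne_zero y).hasFDerivAt
    have hu1 := (hu.differentiable (by norm_num) y).hasFDerivAt
    have : HasFDerivAt (greenField k u x i) _ y := (hK.mul hui).sub (hu1.mul (hS.mul hc))
    rw [this.fderiv]
    simp [EuclideanSpace.inner_single_right]
    ring
  have hn : ∑ i, ((y i - x i : ℝ) : ℂ) ^ 2 = (‖x - y‖ : ℂ) ^ 2 := by
    rw [norm_sub_rev]
    have := EuclideanSpace.real_norm_sq_eq (y - x)
    simp only [PiLp.sub_apply] at this
    exact_mod_cast this.symm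
  have hL := greenSlope_laplacian k h0
  have : ∑ i, fderiv ℝ (fun z => fderiv ℝ u z (basisVec i)) y (basisVec i)
      = g y - (k : ℂ) ^ 2 * u y := by rw [← hH y]; ring
  simp only [hpart]
  rw [Finset.sum_sub_distrib, ← Finset.mul_sum, this, ← Finset.mul_sum, Finset.sum_add_distrib,
    ← Finset.mul_sum, hn]
  simp only [Finset.sum_const, Finset.card_univ, Fintype.card_fin, nsmul_eq_mul]
  push_cast
  linear_combination -u y * hL

lemma fderiv_apply_eq_sum (u : E3 → ℂ) (y v : E3) :
    fderiv ℝ u y v = ∑ i, ((v i : ℝ) : ℂ) * fderiv ℝ u y (basisVec i) := by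
  have hv : v = ∑ i, v i • basisVec i := by
    ext j
    fin_cases j <;> simp [Fin.sum_univ_three]
  conv_lhs => rw [hv]
  rw [map_sum]
  simp

/-- Contraction of `K ∇u - u ∇K` with a vector. -/
lemma sum_mul_greenField (k : ℝ) (u : E3 → ℂ) (x y v : E3) :
    ∑ i, ((v i : ℝ) : ℂ) * greenField k u x i y
      = greenProfile k ‖x - y‖ * fderiv ℝ u y v
        - u y * (greenSlope k ‖x - y‖ * ((inner ℝ (y - x) v : ℝ) : ℂ)) := by
  rw [fderiv_apply_eq_sum u y v, PiLp.inner_apply]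
  simp only [greenField, Fin.sum_univ_three]
  simp
  ring

/-- The flux density of `K ∇u - u ∇K` across the cutoff region of `cutoff a r`. -/
noncomputable def flux (k : ℝ) (u : E3 → ℂ) (x a : E3) (r : ℝ) (y : E3) : ℂ :=
  cutoffWeight a r y * (greenProfile k ‖x - y‖ * fderiv ℝ u y (y - a)
    - u y * (greenSlope k ‖x - y‖ * ((inner ℝ (y - x) (y - a) : ℝ) : ℂ)))

lemma integrable_flux_zero (k : ℝ) {u : E3 → ℂ} (hu : ContDiff ℝ 2 u) {x : E3} {R : ℝ}
    (hR : ‖x‖ < R) : Integrable (flux k u x 0 R) := by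
  have hR0 : 0 < R := (norm_nonneg x).trans_lt hR
  refine Continuous.integrable_of_hasCompactSupport ?_ ?_
  · refine continuous_mul_of_continuousAt_tsupport (s := {y | R ≤ ‖y - 0‖})
      (isClosed_le continuous_const (by fun_prop)) (continuous_cutoffWeight 0 R) ?_ ?_
    · intro y hy
      by_contra h
      exact hy (cutoffWeight_support hR0 h).1
    · intro y hy
      have hyx : y ≠ x := by
        rintro rfl
        simp at hy
        linarith
      simp only [← sum_mul_greenField]
      refine tendsto_finsetSum _ fun i _ => ContinuousAt.mul ?_
        (contDiffAt_greenField k hu hyx i).continuousAt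
      have : Continuous fun y : E3 => (((y - 0) i : ℝ) : ℂ) := by fun_prop
      exact this.continuousAt
  · exact HasCompactSupport.mul_right
      ((hasCompactSupport_cutoffWeight 0 hR0).comp_left (g := ((↑) : ℝ → ℂ)) (by simp))

lemma integral_cutoff_greenProfile {k : ℝ} {u g : E3 → ℂ} (hu : ContDiff ℝ 2 u)
    (hH : ∀ y, (∑ i, fderiv ℝ (fun z => fderiv ℝ u z (basisVec i)) y (basisVec i))
      + (k : ℂ) ^ 2 * u y = g y) {x : E3} {R r : ℝ} (hR : ‖x‖ < R) (hr : 0 < r) :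
    ∫ y, ((cutoff 0 R y - cutoff x r y : ℝ) : ℂ) * (greenProfile k ‖x - y‖ * g y)
      = (∫ y, flux k u x 0 R y) - ∫ y, flux k u x x r y := by
  have hR0 : 0 < R := (norm_nonneg x).trans_lt hR
  set φ : E3 → ℝ := fun y => cutoff 0 R y - cutoff x r y with hφdef
  have hφ : ContDiff ℝ 1 φ := (contDiff_cutoff 0 R).sub (contDiff_cutoff x r)
  have hφs : HasCompactSupport φ :=
    (hasCompactSupport_cutoff 0 hR0).sub (hasCompactSupport_cutoff x hr)
  have hx : x ∉ tsupport φ := by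
    rw [notMem_tsupport_iff_eventuallyEq]
    have h1 : ∀ᶠ y in 𝓝 x, ‖y - 0‖ < R :=
      (show Continuous fun y : E3 => ‖y - 0‖ by fun_prop).continuousAt.eventually_lt
        continuousAt_const (by simpa using hR)
    have h2 : ∀ᶠ y in 𝓝 x, ‖y - x‖ < r :=
      (show Continuous fun y : E3 => ‖y - x‖ by fun_prop).continuousAt.eventually_lt
        continuousAt_const (by simpa using hr)
    filter_upwards [h1, h2] with y hy1 hy2
    simp [hφdef, cutoff_eq_one hR0 hy1.le, cutoff_eq_one hr hy2.le]
  have hne : ∀ y ∈ tsupport φ, y ≠ x := by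
    rintro y hy rfl
    exact hx hy
  obtain ⟨-, hB, hI⟩ := integral_cutoff_div hφ hφs
    (V := greenField k u x) fun i y hy => contDiffAt_greenField k hu (hne y hy) i
  have hL : ∀ y, (φ y : ℂ) * ∑ i, fderiv ℝ (greenField k u x i) y (basisVec i)
      = (φ y : ℂ) * (greenProfile k ‖x - y‖ * g y) := by
    intro y
    by_cases hy : y ∈ tsupport φ
    · rw [sum_fderiv_greenField hu hH (hne y hy)]
    · simp [image_eq_zero_of_notMem_tsupport hy]
  have hD : ∀ y, ∑ i, (fderiv ℝ φ y (basisVec i) : ℂ) * greenField k u x i y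
      = flux k u x x r y - flux k u x 0 R y := by
    intro y
    have : HasFDerivAt φ _ y := (hasFDerivAt_cutoff 0 R y).sub (hasFDerivAt_cutoff x r y)
    rw [this.fderiv, flux, flux, ← sum_mul_greenField, ← sum_mul_greenField]
    simp [Fin.sum_univ_three, EuclideanSpace.inner_single_right]
    ring
  simp only [hL, hD] at hI hB
  rw [hI]
  have hfar := integrable_flux_zero k hu hR
  have hnear : Integrable (flux k u x x r) := by
    have := hB.add hfar
    refine this.congr (.of_forall fun y => ?_)
    simp
  rw [integral_sub hnear hfar]
  ring

/-- The `L²` mass of an outgoing solution in dyadic shells grows at most linearly. -/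
lemma exists_integral_cutoffWeight_norm_sq_le {k : ℝ} (hk : 0 < k) {u g : E3 → ℂ}
    (hu : ContDiff ℝ 2 u) (hg : Continuous g) (hgs : HasCompactSupport g)
    (hH : ∀ y, (∑ i, fderiv ℝ (fun z => fderiv ℝ u z (basisVec i)) y (basisVec i))
      + (k : ℂ) ^ 2 * u y = g y)
    (hS : ∀ ε : ℝ, 0 < ε → ∃ R : ℝ, ∀ y : E3, R ≤ ‖y‖ →
      ‖fderiv ℝ u y y - Complex.I * k * ‖y‖ * u y‖ ≤ ε) :
    ∃ M : ℝ, ∀ᶠ R in atTop, R * ∫ y, cutoffWeight 0 R y * ‖u y‖ ^ 2 ≤ M := by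
  obtain ⟨R₀, hR₀⟩ := hS 1 one_pos
  set c := ∫ z : E3, cutoffWeight 0 1 z
  set A := ∫ y, ‖u y‖ * ‖g y‖
  have hAi : Integrable fun y => ‖u y‖ * ‖g y‖ :=
    (hu.continuous.norm.mul hg.norm).integrable_of_hasCompactSupport hgs.norm.mul_left
  refine ⟨(c + 2 * k * A) / k ^ 2, ?_⟩
  filter_upwards [eventually_ge_atTop R₀, eventually_gt_atTop 0] with R hR hR0
  have hV : ∀ i : Fin 3, ContDiff ℝ 1 fun y => star (u y) * fderiv ℝ u y (basisVec i) := fun i =>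
    ((Complex.conjCLE.contDiff (n := 1)).comp (hu.of_le (by norm_num))).mul
      (contDiff_fderiv_apply hu _)
  have hws := hasCompactSupport_cutoffWeight 0 hR0
  have hwc := continuous_cutoffWeight 0 R
  have huc := hu.continuous
  have hpc : Continuous fun y : E3 => fderiv ℝ u y y :=
    (hu.continuous_fderiv (by norm_num)).clm_apply continuous_id
  obtain ⟨hA, -, hI⟩ := integral_cutoff_div (contDiff_cutoff 0 R) (hasCompactSupport_cutoff 0 hR0)
    (V := fun i y => star (u y) * fderiv ℝ u y (basisVec i)) fun i y _ => (hV i).contDiffAt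
  have hD : ∀ y, ∑ i, (fderiv ℝ (cutoff 0 R) y (basisVec i) : ℂ)
        * (star (u y) * fderiv ℝ u y (basisVec i))
      = -(cutoffWeight 0 R y * (star (u y) * fderiv ℝ u y y)) := by
    intro y
    rw [(hasFDerivAt_cutoff 0 R y).fderiv, fderiv_apply_eq_sum u y y]
    simp [Fin.sum_univ_three, EuclideanSpace.inner_single_right]
    ring
  have hWi : Integrable fun y => (cutoffWeight 0 R y : ℂ) * (star (u y) * fderiv ℝ u y y) := by
    refine Continuous.integrable_of_hasCompactSupport ?_ ?_
    · fun_prop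
    · exact HasCompactSupport.mul_right (hws.comp_left (g := ((↑) : ℝ → ℂ)) (by simp))
  simp only [hD, integral_neg, neg_neg] at hI
  have hIm : ∀ y, (∑ i, fderiv ℝ (fun y => star (u y) * fderiv ℝ u y (basisVec i)) y
      (basisVec i)).im = (star (u y) * g y).im := by
    intro y
    have hu1 := (hu.differentiable (by norm_num) y).hasFDerivAt
    have hus : HasFDerivAt (fun y => star (u y))
        ((Complex.conjCLE : ℂ →L[ℝ] ℂ).comp (fderiv ℝ u y)) y :=
      (Complex.conjCLE : ℂ →L[ℝ] ℂ).hasFDerivAt.comp y hu1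
    have hpart : ∀ i : Fin 3, fderiv ℝ (fun y => star (u y) * fderiv ℝ u y (basisVec i)) y
        (basisVec i) = star (u y) * fderiv ℝ (fun z => fderiv ℝ u z (basisVec i)) y (basisVec i)
          + ((‖fderiv ℝ u y (basisVec i)‖ ^ 2 : ℝ) : ℂ) := by
      intro i
      have hui :=
        ((contDiff_fderiv_apply hu (basisVec i)).differentiable one_ne_zero y).hasFDerivAt
      have : HasFDerivAt (fun y => star (u y) * fderiv ℝ u y (basisVec i)) _ y := hus.mul hui
      rw [HasFDerivAt.fderiv this]
      have hc := Complex.conj_mul' (fderiv ℝ u y (basisVec i))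
      simp only [add_apply, smul_apply, smul_eq_mul,
        ContinuousLinearMap.comp_apply, Complex.ofReal_pow, ← hc]
      simp
      ring
    have hL : ∑ i, fderiv ℝ (fun z => fderiv ℝ u z (basisVec i)) y (basisVec i)
      = g y - (k : ℂ) ^ 2 * u y := by rw [← hH y]; ring
    simp only [hpart]
    rw [Finset.sum_add_distrib, ← Finset.mul_sum, hL, ← Complex.ofReal_sum]
    have hc : star (u y) * u y = ((‖u y‖ ^ 2 : ℝ) : ℂ) := by
      simpa using Complex.conj_mul' (u y)
    have : star (u y) * (g y - (k : ℂ) ^ 2 * u y)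
        = star (u y) * g y - ((k ^ 2 * ‖u y‖ ^ 2 : ℝ) : ℂ) := by
      rw [mul_sub, mul_left_comm, hc]; push_cast; ring
    rw [this, Complex.add_im, Complex.sub_im, Complex.ofReal_im, Complex.ofReal_im]
    ring
  have hflux : ∫ y, cutoffWeight 0 R y * (star (u y) * fderiv ℝ u y y).im ≤ A := by
    have e1 : ∫ y, cutoffWeight 0 R y * (star (u y) * fderiv ℝ u y y).im
        = (∫ y, (cutoffWeight 0 R y : ℂ) * (star (u y) * fderiv ℝ u y y)).im := by
      have := Complex.imCLM.integral_comp_comm hWi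
      simpa [Complex.im_ofReal_mul] using this
    have e2 := Complex.imCLM.integral_comp_comm hA
    rw [e1, ← hI, ← Complex.imCLM_apply, ← e2]
    refine integral_mono (Complex.imCLM.integrable_comp hA) hAi fun y => ?_
    simp only [Complex.imCLM_apply, Complex.im_ofReal_mul, hIm]
    calc cutoff 0 R y * (star (u y) * g y).im
        ≤ cutoff 0 R y * ‖star (u y) * g y‖ :=
          mul_le_mul_of_nonneg_left ((le_abs_self _).trans (Complex.abs_im_le_norm _))
            (cutoff_nonneg _ _ _)
      _ ≤ 1 * ‖star (u y) * g y‖ :=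
          mul_le_mul_of_nonneg_right (cutoff_le_one _ _ _) (norm_nonneg _)
      _ = ‖u y‖ * ‖g y‖ := by rw [one_mul, norm_mul, norm_star]
  have hwi : Integrable (cutoffWeight 0 R) := hwc.integrable_of_hasCompactSupport hws
  have hwui : Integrable fun y => cutoffWeight 0 R y * ‖u y‖ ^ 2 :=
    (hwc.mul (huc.norm.pow 2)).integrable_of_hasCompactSupport hws.mul_right
  have hwpi : Integrable fun y => cutoffWeight 0 R y * (star (u y) * fderiv ℝ u y y).im :=
    (hwc.mul (by fun_prop)).integrable_of_hasCompactSupport hws.mul_right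
  have hmain : k ^ 2 * R * ∫ y, cutoffWeight 0 R y * ‖u y‖ ^ 2
      ≤ R⁻¹ * (∫ y, cutoffWeight 0 R y)
        + 2 * k * ∫ y, cutoffWeight 0 R y * (star (u y) * fderiv ℝ u y y).im := by
    rw [← integral_const_mul, ← integral_const_mul, ← integral_const_mul,
      ← integral_add (hwi.const_mul _) (hwpi.const_mul _)]
    refine integral_mono (hwui.const_mul _) ((hwi.const_mul _).add (hwpi.const_mul _)) fun y => ?_
    by_cases hy : cutoffWeight 0 R y = 0
    · simp [hy]
    have hRy : R ≤ ‖y‖ := by simpa using (cutoffWeight_support hR0 hy).1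
    have hs := hR₀ y (hR.trans hRy)
    have hsq : ‖fderiv ℝ u y y - Complex.I * k * ‖y‖ * u y‖ ^ 2 ≤ 1 :=
      pow_le_one₀ (norm_nonneg _) hs
    have hexp : ‖y‖ * (k ^ 2 * ‖y‖ * ‖u y‖ ^ 2)
        ≤ ‖fderiv ℝ u y y - Complex.I * k * ‖y‖ * u y‖ ^ 2
          + ‖y‖ * (2 * k * (star (u y) * fderiv ℝ u y y).im) := by
      simp only [Complex.sq_norm, Complex.normSq_apply]
      simp
      nlinarith [sq_nonneg (fderiv ℝ u y y).re, sq_nonneg (fderiv ℝ u y y).im]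
    have hy0 : 0 < ‖y‖ := hR0.trans_le hRy
    have hb : k ^ 2 * R * ‖u y‖ ^ 2 ≤ R⁻¹ + 2 * k * (star (u y) * fderiv ℝ u y y).im := by
      have h1 : k ^ 2 * ‖y‖ * ‖u y‖ ^ 2 ≤ ‖y‖⁻¹ + 2 * k * (star (u y) * fderiv ℝ u y y).im := by
        refine le_of_mul_le_mul_left ?_ hy0
        rw [mul_add, mul_inv_cancel₀ hy0.ne']
        linarith
      have h2 : ‖y‖⁻¹ ≤ R⁻¹ := inv_anti₀ hR0 hRy
      have h3 : k ^ 2 * R * ‖u y‖ ^ 2 ≤ k ^ 2 * ‖y‖ * ‖u y‖ ^ 2 := by gcongr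
      linarith
    have := mul_le_mul_of_nonneg_left hb (cutoffWeight_nonneg 0 R y)
    simp only
    linarith
  rw [integral_cutoffWeight 0 hR0, inv_mul_cancel_left₀ hR0.ne'] at hmain
  rw [le_div_iff₀ (by positivity)]
  have : 2 * k * ∫ y, cutoffWeight 0 R y * (star (u y) * fderiv ℝ u y y).im ≤ 2 * k * A := by
    gcongr
  linarith

lemma norm_exp_I_mul_mul (k s : ℝ) : ‖-Complex.exp (Complex.I * k * s)‖ = 1 := by
  rw [norm_neg, show Complex.I * (k : ℂ) * s = ((k * s : ℝ) : ℂ) * Complex.I by push_cast; ring,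
    Complex.norm_exp_ofReal_mul_I]

lemma norm_greenProfile (k : ℝ) {s : ℝ} (hs : 0 ≤ s) :
    ‖greenProfile k s‖ = (4 * Real.pi * s)⁻¹ := by
  rw [greenProfile, norm_div, norm_exp_I_mul_mul, one_div]
  congr 1
  simp [abs_of_nonneg hs, abs_of_pos Real.pi_pos]

/-- The radial part of `∇K - i k K` at `y` is `O(‖y‖⁻²)`. -/
lemma norm_greenProfile_radiation_le {k : ℝ} (hk : 0 < k) {x y : E3} {R : ℝ} (hR : 0 < R)
    (hxR : 2 * ‖x‖ ≤ R) (hy : R ≤ ‖y‖) (hy2 : ‖y‖ ≤ 2 * R) :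
    ‖Complex.I * k * ‖y‖ * greenProfile k ‖x - y‖
        - greenSlope k ‖x - y‖ * ((inner ℝ (y - x) y : ℝ) : ℂ)‖
      ≤ (4 * k * ‖x‖ + 8) / R := by
  set ρ := ‖x - y‖ with hρ
  set t := ‖y‖
  set d : ℝ := inner ℝ (y - x) y
  have hρR : R / 2 ≤ ρ := by
    have : ‖y‖ - ‖x‖ ≤ ‖x - y‖ := by rw [norm_sub_rev]; exact norm_sub_norm_le y x
    linarith
  have hρ0 : 0 < ρ := by linarith
  have hρc : (ρ : ℂ) ≠ 0 := by exact_mod_cast hρ0.ne'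
  have hpi : (Real.pi : ℂ) ≠ 0 := by exact_mod_cast Real.pi_ne_zero
  have heq : Complex.I * k * t * greenProfile k ρ - greenSlope k ρ * (d : ℂ)
      = -Complex.exp (Complex.I * k * ρ) * (((4 * Real.pi : ℝ) : ℂ))⁻¹ *
        (Complex.I * ((k * ((t * ρ - d) / ρ ^ 2) : ℝ) : ℂ) + ((d / ρ ^ 3 : ℝ) : ℂ)) := by
    simp only [greenProfile, greenSlope]
    push_cast
    field_simp
    ring
  have hd : |d| ≤ ρ * t := by
    have := abs_real_inner_le_norm (y - x) y
    rwa [norm_sub_rev] at this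
  have hdx : |t * ρ - d| ≤ 2 * ρ * ‖x‖ := by
    have h1 : d = ρ ^ 2 + inner ℝ (y - x) x := by
      have : y = (y - x) + x := by abel
      change inner ℝ (y - x) y = _
      conv_lhs => rw [this]
      rw [add_sub_cancel_right, inner_add_right, real_inner_self_eq_norm_sq, hρ, norm_sub_rev]
    have h2 : |inner ℝ (y - x) x| ≤ ρ * ‖x‖ := by
      have := abs_real_inner_le_norm (y - x) x
      rwa [norm_sub_rev] at this
    have h3 : |t - ρ| ≤ ‖x‖ := by
      have := abs_norm_sub_norm_le y (y - x)
      rwa [sub_sub_cancel, norm_sub_rev y x] at this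
    have h4 : t * ρ - d = ρ * (t - ρ) - inner ℝ (y - x) x := by rw [h1]; ring
    rw [h4]
    calc |ρ * (t - ρ) - inner ℝ (y - x) x| ≤ |ρ * (t - ρ)| + |inner ℝ (y - x) x| := abs_sub _ _
      _ ≤ ρ * ‖x‖ + ρ * ‖x‖ := by
          rw [abs_mul, abs_of_pos hρ0]; gcongr
      _ = 2 * ρ * ‖x‖ := by ring
  have b1 : |k * ((t * ρ - d) / ρ ^ 2)| ≤ 4 * k * ‖x‖ / R := by
    rw [abs_mul, abs_of_pos hk, abs_div, abs_of_pos (pow_pos hρ0 2)]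
    calc k * (|t * ρ - d| / ρ ^ 2) ≤ k * (2 * ρ * ‖x‖ / ρ ^ 2) := by gcongr
      _ = 2 * k * ‖x‖ / ρ := by field_simp
      _ ≤ 2 * k * ‖x‖ / (R / 2) := by gcongr
      _ = 4 * k * ‖x‖ / R := by field_simp; ring
  have b2 : |d / ρ ^ 3| ≤ 8 / R := by
    rw [abs_div, abs_of_pos (pow_pos hρ0 3)]
    calc |d| / ρ ^ 3 ≤ ρ * t / ρ ^ 3 := by gcongr
      _ = t / ρ ^ 2 := by field_simp
      _ ≤ 2 * R / (R / 2) ^ 2 := by gcongr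
      _ = 8 / R := by field_simp; ring
  have hpi1 : (4 * Real.pi)⁻¹ ≤ 1 := inv_le_one_of_one_le₀ (by linarith [Real.pi_gt_three])
  rw [heq, norm_mul, norm_mul, norm_exp_I_mul_mul, norm_inv, Complex.norm_real,
    Real.norm_of_nonneg (by positivity), one_mul]
  calc (4 * Real.pi)⁻¹ * _ ≤ 1 * (4 * k * ‖x‖ / R + 8 / R) := by
        refine mul_le_mul hpi1 ((norm_add_le _ _).trans (add_le_add ?_ ?_)) (norm_nonneg _)
          zero_le_one
        · rw [norm_mul, Complex.norm_I, one_mul, Complex.norm_real, Real.norm_eq_abs]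
          exact b1
        · rw [Complex.norm_real, Real.norm_eq_abs]
          exact b2
    _ = (4 * k * ‖x‖ + 8) / R := by ring

lemma tendsto_integral_flux_atTop {k : ℝ} (hk : 0 < k) {u g : E3 → ℂ}
    (hu : ContDiff ℝ 2 u) (hg : Continuous g) (hgs : HasCompactSupport g)
    (hH : ∀ y, (∑ i, fderiv ℝ (fun z => fderiv ℝ u z (basisVec i)) y (basisVec i))
      + (k : ℂ) ^ 2 * u y = g y)
    (hS : ∀ ε : ℝ, 0 < ε → ∃ R : ℝ, ∀ y : E3, R ≤ ‖y‖ →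
      ‖fderiv ℝ u y y - Complex.I * k * ‖y‖ * u y‖ ≤ ε) (x : E3) :
    Tendsto (fun R => ∫ y, flux k u x 0 R y) atTop (𝓝 0) := by
  obtain ⟨M, hM⟩ := exists_integral_cutoffWeight_norm_sq_le hk hu hg hgs hH hS
  set c := ∫ z : E3, cutoffWeight 0 1 z
  have hc : 0 ≤ c := integral_nonneg (cutoffWeight_nonneg 0 1)
  set C := 4 * k * ‖x‖ + 8 with hC
  have hC0 : 0 ≤ C := by positivity
  have hbound : ∀ ε > 0, ∀ᶠ R in atTop, ‖∫ y, flux k u x 0 R y‖ ≤ ε * c + C * (M + c) * R⁻¹ := by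
    intro ε hε
    obtain ⟨R₀, hR₀⟩ := hS ε hε
    filter_upwards [hM, eventually_ge_atTop R₀, eventually_gt_atTop 0,
      eventually_ge_atTop (2 * ‖x‖)] with R hMR hRR₀ hR hRx
    have hws := hasCompactSupport_cutoffWeight 0 hR
    have hwc := continuous_cutoffWeight 0 R
    have hwi : Integrable (cutoffWeight 0 R) := hwc.integrable_of_hasCompactSupport hws
    have hwui : Integrable fun y => cutoffWeight 0 R y * ‖u y‖ ^ 2 :=
      (hwc.mul (hu.continuous.norm.pow 2)).integrable_of_hasCompactSupport hws.mul_right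
    have hpt : ∀ y, ‖flux k u x 0 R y‖ ≤ ((ε + C / R) / R) * cutoffWeight 0 R y
        + C * (cutoffWeight 0 R y * ‖u y‖ ^ 2) := by
      intro y
      by_cases hy : cutoffWeight 0 R y = 0
      · simp [flux, hy]
      obtain ⟨hy1, hy2⟩ := cutoffWeight_support hR hy
      rw [sub_zero] at hy1 hy2
      have hs := hR₀ y (hRR₀.trans hy1)
      have hK : ‖greenProfile k ‖x - y‖‖ ≤ R⁻¹ := by
        have : ‖y‖ - ‖x‖ ≤ ‖x - y‖ := by rw [norm_sub_rev]; exact norm_sub_norm_le y x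
        rw [norm_greenProfile k (norm_nonneg _)]
        refine inv_anti₀ hR ?_
        nlinarith [Real.pi_gt_three]
      have hrad := norm_greenProfile_radiation_le hk hR hRx hy1 hy2
      have hsplit : greenProfile k ‖x - y‖ * fderiv ℝ u y y
            - u y * (greenSlope k ‖x - y‖ * ((inner ℝ (y - x) y : ℝ) : ℂ))
          = greenProfile k ‖x - y‖ * (fderiv ℝ u y y - Complex.I * k * ‖y‖ * u y)
            + u y * (Complex.I * k * ‖y‖ * greenProfile k ‖x - y‖
              - greenSlope k ‖x - y‖ * ((inner ℝ (y - x) y : ℝ) : ℂ)) := by ring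
      have hamgm : ‖u y‖ * R⁻¹ ≤ ‖u y‖ ^ 2 + R⁻¹ * R⁻¹ := by
        nlinarith [sq_nonneg (‖u y‖ - R⁻¹), sq_nonneg (‖u y‖), sq_nonneg R⁻¹]
      simp only [flux, sub_zero]
      rw [norm_mul, Complex.norm_real, Real.norm_of_nonneg (cutoffWeight_nonneg _ _ _), hsplit]
      calc cutoffWeight 0 R y * _
          ≤ cutoffWeight 0 R y * (R⁻¹ * ε + ‖u y‖ * (C / R)) := by
            refine mul_le_mul_of_nonneg_left ((norm_add_le _ _).trans (add_le_add ?_ ?_))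
              (cutoffWeight_nonneg _ _ _)
            · rw [norm_mul]; gcongr
            · rw [norm_mul]; gcongr
        _ = cutoffWeight 0 R y * (R⁻¹ * ε + C * (‖u y‖ * R⁻¹)) := by ring
        _ ≤ cutoffWeight 0 R y * (R⁻¹ * ε + C * (‖u y‖ ^ 2 + R⁻¹ * R⁻¹)) := by
            gcongr
            exact cutoffWeight_nonneg _ _ _
        _ = _ := by ring
    have hI := norm_integral_le_of_norm_le ((hwi.const_mul _).add (hwui.const_mul C))
      (.of_forall hpt)
    refine hI.trans ?_
    simp only [Pi.add_apply]
    rw [integral_add (hwi.const_mul _) (hwui.const_mul C), integral_const_mul,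
      integral_const_mul, integral_cutoffWeight 0 hR]
    have h1 : (ε + C / R) / R * (R * c) = ε * c + C * c * R⁻¹ := by field_simp
    have h2 : ∫ y, cutoffWeight 0 R y * ‖u y‖ ^ 2 ≤ M * R⁻¹ := by
      rw [← div_eq_mul_inv, le_div_iff₀ hR]; linarith
    have h3 := mul_le_mul_of_nonneg_left h2 hC0
    change (ε + C / R) / R * (R * c) + _ ≤ _
    rw [h1]
    linarith
  rw [tendsto_zero_iff_norm_tendsto_zero, Metric.tendsto_nhds]
  intro η hη
  have hlim : Tendsto (fun R : ℝ => C * (M + c) * R⁻¹) atTop (𝓝 0) := by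
    simpa using tendsto_inv_atTop_zero.const_mul (C * (M + c))
  filter_upwards [hbound (η / (2 * (c + 1))) (by positivity),
    hlim.eventually_lt_const (half_pos hη)] with R h1 h2
  have : η / (2 * (c + 1)) * c ≤ η / 2 := by
    rw [div_mul_eq_mul_div, div_le_div_iff₀ (by positivity) two_pos]
    nlinarith
  rw [dist_zero_right, norm_norm]
  linarith

lemma tendsto_integral_flux_self (k : ℝ) {u : E3 → ℂ} (hu : ContDiff ℝ 2 u) (x : E3) :
    Tendsto (fun r => ∫ y, flux k u x x r y) (𝓝[>] 0) (𝓝 (-u x)) := by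
  set Φ : ℝ → E3 → ℂ := fun r z => cutoffWeight 0 1 z *
    (-(r : ℂ) * Complex.exp (Complex.I * k * (r * max ‖z‖ 1 : ℝ)) / (4 * Real.pi * (max ‖z‖ 1 : ℝ))
        * fderiv ℝ u (x + r • z) z
      - u (x + r • z) * (-Complex.exp (Complex.I * k * (r * max ‖z‖ 1 : ℝ)) / (4 * Real.pi)
        * (Complex.I * k * r - 1 / (max ‖z‖ 1 : ℝ)))) with hΦ
  have hpi : (Real.pi : ℂ) ≠ 0 := by exact_mod_cast Real.pi_ne_zero
  have hcont : Continuous (Function.uncurry Φ) := by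
    have hw := continuous_cutoffWeight 0 1
    have huc := hu.continuous
    have hdu := hu.continuous_fderiv (by norm_num)
    have hm : Continuous fun p : ℝ × E3 => ((max ‖p.2‖ 1 : ℝ) : ℂ) := by fun_prop
    have hm0 : ∀ p : ℝ × E3, ((max ‖p.2‖ 1 : ℝ) : ℂ) ≠ 0 := fun p => by
      exact_mod_cast (zero_lt_one.trans_le (le_max_right ‖p.2‖ 1)).ne'
    have hd : Continuous fun p : ℝ × E3 => fderiv ℝ u (x + p.1 • p.2) p.2 :=
      (hdu.comp (by fun_prop)).clm_apply continuous_snd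
    have h1 : Continuous fun p : ℝ × E3 => -(p.1 : ℂ) * Complex.exp (Complex.I * k *
        (p.1 * max ‖p.2‖ 1 : ℝ)) / (4 * Real.pi * (max ‖p.2‖ 1 : ℝ)) :=
      Continuous.div (by fun_prop) (by fun_prop) fun p =>
        mul_ne_zero (mul_ne_zero (by norm_num) hpi) (hm0 p)
    have h2 : Continuous fun p : ℝ × E3 => (1 : ℂ) / (max ‖p.2‖ 1 : ℝ) :=
      continuous_const.div hm hm0
    refine Continuous.mul (by fun_prop) ((h1.mul hd).sub (Continuous.mul (by fun_prop) ?_))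
    exact Continuous.mul (by fun_prop) (Continuous.sub (by fun_prop) h2)
  have hset : ∀ r, ∫ z, Φ r z = ∫ z in Metric.closedBall 0 2, Φ r z := by
    intro r
    refine (setIntegral_eq_integral_of_forall_compl_eq_zero fun z hz => ?_).symm
    have : cutoffWeight 0 1 z = 0 := by
      by_contra h
      exact hz (by simpa using (cutoffWeight_support one_pos h).2)
    simp [hΦ, this]
  have hlim : Tendsto (fun r => ∫ z, Φ r z) (𝓝[>] 0) (𝓝 (∫ z, Φ 0 z)) := by
    simp only [hset]
    exact ((continuous_parametric_integral_of_continuous hcont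
      (isCompact_closedBall (0 : E3) 2)).tendsto 0).mono_left nhdsWithin_le_nhds
  have h0 : ∫ z, Φ 0 z = -u x := by
    have : ∀ z, Φ 0 z = -u x * ((cutoffWeight 0 1 z / (4 * Real.pi * ‖z‖) : ℝ) : ℂ) := by
      intro z
      by_cases hz : cutoffWeight 0 1 z = 0
      · simp [hΦ, hz]
      have h1 : 1 ≤ ‖z‖ := by simpa using (cutoffWeight_support one_pos hz).1
      simp only [hΦ, max_eq_left h1]
      simp
      field_simp
    simp only [this]
    rw [integral_const_mul, integral_complex_ofReal, integral_cutoffWeight_div_norm]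
    simp
  rw [h0] at hlim
  refine hlim.congr' ?_
  filter_upwards [self_mem_nhdsWithin] with r hr
  have hr : 0 < r := hr
  have hrc : (r : ℂ) ≠ 0 := by exact_mod_cast hr.ne'
  rw [integral_eq_scale (flux k u x x r) x hr, ← integral_smul]
  congr 1
  funext z
  by_cases hz : cutoffWeight 0 1 z = 0
  · simp [hΦ, flux, cutoffWeight_eq_scale x hr, hz]
  have h1 : 1 ≤ ‖z‖ := by simpa using (cutoffWeight_support one_pos hz).1
  have hzc : (‖z‖ : ℂ) ≠ 0 := by exact_mod_cast (zero_lt_one.trans_le h1).ne'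
  have hn : ‖x - (x + r • z)‖ = r * ‖z‖ := by
    rw [sub_add_cancel_left, norm_neg, norm_smul, Real.norm_of_nonneg hr.le]
  have hin : inner ℝ (r • z) (r • z) = r ^ 2 * ‖z‖ ^ 2 := by
    rw [real_inner_self_eq_norm_sq, norm_smul, Real.norm_of_nonneg hr.le]; ring
  simp only [hΦ, max_eq_left h1, flux, cutoffWeight_eq_scale x hr, hn, add_sub_cancel_left, hin,
    map_smul, greenProfile, greenSlope, Complex.real_smul]
  push_cast
  field_simp

lemma measurable_greenProfile (k : ℝ) : Measurable (greenProfile k) := by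
  unfold greenProfile
  fun_prop

lemma integrable_greenProfile_mul (k : ℝ) (x : E3) {g : E3 → ℂ} (hg : Continuous g)
    (hgs : HasCompactSupport g) : Integrable fun y => greenProfile k ‖x - y‖ * g y := by
  have hm : Measurable fun z : E3 => greenProfile k ‖z‖ :=
    (measurable_greenProfile k).comp measurable_norm
  have hloc : LocallyIntegrable (fun z : E3 => greenProfile k ‖z‖) := by
    refine locallyIntegrable_of_norm_le_rpow (C := (4 * Real.pi)⁻¹) (α := 1) (by simp) (by simp)
      (.of_forall fun z => ?_) hm.aestronglyMeasurable
    rw [norm_greenProfile k (norm_nonneg _), Real.rpow_neg_one, mul_inv]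
  have hcs : HasCompactSupport fun z => g (x - z) :=
    hgs.comp_homeomorph (Homeomorph.subLeft x)
  have := hloc.integrable_smul_right_of_hasCompactSupport
    (g := fun z => g (x - z)) (by fun_prop) hcs
  have := this.comp_sub_left x
  simpa using this

/-- The Green representation of an outgoing solution of the Helmholtz equation. -/
lemma eq_integral_greenProfile {k : ℝ} (hk : 0 < k) {u g : E3 → ℂ}
    (hu : ContDiff ℝ 2 u) (hg : Continuous g) (hgs : HasCompactSupport g)
    (hH : ∀ y, (∑ i, fderiv ℝ (fun z => fderiv ℝ u z (basisVec i)) y (basisVec i))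
      + (k : ℂ) ^ 2 * u y = g y)
    (hS : ∀ ε : ℝ, 0 < ε → ∃ R : ℝ, ∀ y : E3, R ≤ ‖y‖ →
      ‖fderiv ℝ u y y - Complex.I * k * ‖y‖ * u y‖ ≤ ε) (x : E3) :
    u x = ∫ y, greenProfile k ‖x - y‖ * g y := by
  have hfar := tendsto_integral_flux_atTop hk hu hg hgs hH hS x
  have hnear := (tendsto_integral_flux_self k hu x).comp tendsto_inv_atTop_nhdsGT_zero
  have hlim : Tendsto (fun R : ℝ => ∫ y, ((cutoff 0 R y - cutoff x R⁻¹ y : ℝ) : ℂ) *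
      (greenProfile k ‖x - y‖ * g y)) atTop (𝓝 (u x)) := by
    have := hfar.sub hnear
    rw [zero_sub, neg_neg] at this
    refine this.congr' ?_
    filter_upwards [eventually_gt_atTop ‖x‖] with R hR
    exact (integral_cutoff_greenProfile hu hH hR
      (inv_pos.2 ((norm_nonneg x).trans_lt hR))).symm
  refine tendsto_nhds_unique hlim ?_
  have hi := integrable_greenProfile_mul k x hg hgs
  refine tendsto_integral_filter_of_dominated_convergence
    (fun y => ‖greenProfile k ‖x - y‖ * g y‖) (.of_forall fun R => ?_)
    (.of_forall fun R => .of_forall fun y => ?_) hi.norm ?_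
  · have hc : Continuous fun y => ((cutoff 0 R y - cutoff x R⁻¹ y : ℝ) : ℂ) :=
      Complex.continuous_ofReal.comp
        ((contDiff_cutoff 0 R).continuous.sub (contDiff_cutoff x R⁻¹).continuous)
    exact hc.aestronglyMeasurable.mul hi.aestronglyMeasurable
  · rw [norm_mul, Complex.norm_real]
    refine mul_le_of_le_one_left (norm_nonneg _) ?_
    rw [Real.norm_eq_abs, abs_le]
    constructor <;> linarith [cutoff_nonneg 0 R y, cutoff_nonneg x R⁻¹ y, cutoff_le_one 0 R y,
      cutoff_le_one x R⁻¹ y]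
  · filter_upwards [Measure.ae_ne volume x] with y hy
    have hyx : 0 < ‖y - x‖ := norm_pos_iff.2 (sub_ne_zero.2 hy)
    refine tendsto_const_nhds.congr' ?_
    filter_upwards [eventually_ge_atTop ‖y‖, eventually_gt_atTop 0,
      eventually_ge_atTop (2 * ‖y - x‖⁻¹)] with R h1 h2 h3
    rw [cutoff_eq_one h2 (by simpa using h1), cutoff_eq_zero (inv_pos.2 h2)]
    · simp
    · have := inv_anti₀ (by positivity) h3
      rw [mul_inv, inv_inv] at this
      linarith

/-- A bounded `C²` solution of the inhomogeneous Helmholtz equation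
`Δu + k₀²u = f + ω²ξu` on `ℝ³` (with `f`, `ξ` continuous and compactly supported)
satisfying the Sommerfeld radiation condition obeys the Lippmann–Schwinger
integral equation with kernel `G(ρ) = −exp(ik₀ρ)/(4πρ)`. -/
theorem stmt_2 (c₀ ω : ℝ) (hω : 0 < ω / c₀)
    (f ξ u : EuclideanSpace ℝ (Fin 3) → ℂ)
    (hf : Continuous f) (hfs : HasCompactSupport f)
    (hξ : Continuous ξ) (hξs : HasCompactSupport ξ)
    (hu : ContDiff ℝ 2 u) (hub : ∃ C : ℝ, ∀ x, ‖u x‖ ≤ C)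
    (hHelm : ∀ x : EuclideanSpace ℝ (Fin 3),
      (∑ i : Fin 3,
          fderiv ℝ (fun y => fderiv ℝ u y (EuclideanSpace.single i 1)) x
            (EuclideanSpace.single i 1))
        + ((ω / c₀ : ℝ) : ℂ) ^ 2 * u x = f x + ((ω : ℝ) : ℂ) ^ 2 * ξ x * u x)
    (hSommerfeld : ∀ ε : ℝ, 0 < ε → ∃ R : ℝ, ∀ x : EuclideanSpace ℝ (Fin 3),
      R ≤ ‖x‖ →
      ‖x‖ * ‖fderiv ℝ u x (‖x‖⁻¹ • x) - Complex.I * ((ω / c₀ : ℝ) : ℂ) * u x‖ ≤ ε) :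
    ∀ x : EuclideanSpace ℝ (Fin 3),
      u x =
        (∫ x' : EuclideanSpace ℝ (Fin 3),
          (-Complex.exp (Complex.I * ((ω / c₀ : ℝ) : ℂ) * ‖x - x'‖) /
            (4 * Real.pi * ‖x - x'‖)) * f x')
        + ((ω : ℝ) : ℂ) ^ 2 *
          ∫ x' : EuclideanSpace ℝ (Fin 3),
            (-Complex.exp (Complex.I * ((ω / c₀ : ℝ) : ℂ) * ‖x - x'‖) /
              (4 * Real.pi * ‖x - x'‖)) * (ξ x' * u x') := by
  intro x
  generalize ω / c₀ = k at hω hHelm hSommerfeld ⊢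
  have hS : ∀ ε : ℝ, 0 < ε → ∃ R : ℝ, ∀ y : E3, R ≤ ‖y‖ →
      ‖fderiv ℝ u y y - Complex.I * k * ‖y‖ * u y‖ ≤ ε := by
    intro ε hε
    obtain ⟨R, hR⟩ := hSommerfeld ε hε
    refine ⟨R, fun y hy => ?_⟩
    rcases eq_or_ne y 0 with rfl | hy0
    · simpa using hε.le
    refine le_of_eq_of_le ?_ (hR y hy)
    have hn : (‖y‖ : ℂ) ≠ 0 := by exact_mod_cast norm_ne_zero_iff.2 hy0
    have : fderiv ℝ u y y - Complex.I * k * ‖y‖ * u y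
        = (‖y‖ : ℂ) * (fderiv ℝ u y (‖y‖⁻¹ • y) - Complex.I * k * u y) := by
      rw [map_smul, Complex.real_smul]
      push_cast
      field_simp
    rw [this, norm_mul, Complex.norm_real, norm_norm]
  have hξu : Continuous fun y => ξ y * u y := hξ.mul hu.continuous
  have hξus : HasCompactSupport fun y => ξ y * u y := hξs.mul_right
  have hH : ∀ y, (∑ i, fderiv ℝ (fun z => fderiv ℝ u z (basisVec i)) y (basisVec i))
      + (k : ℂ) ^ 2 * u y = f y + (ω : ℂ) ^ 2 * (ξ y * u y) := fun y => by
    rw [← mul_assoc]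
    exact hHelm y
  have key := eq_integral_greenProfile hω hu (hf.add (continuous_const.mul hξu))
    (hfs.add hξus.mul_left) hH hS x
  have h1 := integrable_greenProfile_mul k x hf hfs
  have h2 := integrable_greenProfile_mul k x hξu hξus
  have hsum : ∫ y, greenProfile k ‖x - y‖ * (f y + (ω : ℂ) ^ 2 * (ξ y * u y))
      = (∫ y, greenProfile k ‖x - y‖ * f y)
        + (ω : ℂ) ^ 2 * ∫ y, greenProfile k ‖x - y‖ * (ξ y * u y) := by
    rw [← integral_const_mul, ← integral_add h1 (h2.const_mul _)]
    congr 1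
    funext y
    ring
  exact key.trans hsum
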